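/- In the social-event game with threshold r_0 = 1 and parameters a, b, c > 0 with γ = a/c > 1 and b < c(γ − 1), the complete graph K_n is the unique supportable network: (i) K_n is supported by the stable configuration where one agent holds a single event P = V at rate 1; (ii) if a configuration produces a network with some non-adjacent pair (u,v), then agent u strictly increases his utility by additionally holding an event {u,v} at rate 1, so the configuration is not a Nash equilibrium. -/

import Mathlib

open Finset

/-- An event configuration: each agent holds a finite list of events,
each event being a set of attendees together with a rate. -/
abbrev Config (V : Type*) := V → List (Finset V × ℝ)

section Game

variable {V : Type*} [Fintype V] [DecidableEq V]

/-- A valid strategy for `v`: every event contains `v` and has positive rate. -/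
def ValidStrategy (v : V) (s : List (Finset V × ℝ)) : Prop :=
  ∀ e ∈ s, v ∈ e.1 ∧ 0 < e.2

def ConfigValid (cfg : Config V) : Prop := ∀ v, ValidStrategy v (cfg v)

/-- The meeting rate between `u` and `v` supported by `w` (rate of events held by `w`
attended by both `u` and `v`). -/
def rateBy (cfg : Config V) (w u v : V) : ℝ :=
  ((cfg w).map (fun e => if u ∈ e.1 ∧ v ∈ e.1 then e.2 else 0)).sum

/-- The total meeting rate between `u` and `v`. -/
def meet (cfg : Config V) (u v : V) : ℝ := ∑ w, rateBy cfg w u v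

/-- `u` and `v` are connected when their meeting rate is at least the threshold `1`. -/
def connected (cfg : Config V) (u v : V) : Prop := u ≠ v ∧ 1 ≤ meet cfg u v

open scoped Classical in
/-- The set of agents connected to `v`. -/
noncomputable def nbrs (cfg : Config V) (v : V) : Finset V :=
  univ.filter (fun u => connected cfg u v)

/-- The cost of strategy `s` for agent `v` with parameters `b, c`. -/
def stratCost (b c : ℝ) (v : V) (s : List (Finset V × ℝ)) : ℝ :=
  (s.map (fun e => e.2 * (c * ((e.1.erase v).card : ℝ) + b))).sum

/-- Utility of agent `v`: benefit `a` per connection minus cost of own events. -/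
noncomputable def utility (a b c : ℝ) (cfg : Config V) (v : V) : ℝ :=
  a * ((nbrs cfg v).card : ℝ) - stratCost b c v (cfg v)

/-- A configuration is stable when it is valid and is a Nash equilibrium:
no agent can strictly improve her utility by a unilateral change of strategy. -/
def Stable (a b c : ℝ) (cfg : Config V) : Prop :=
  ConfigValid cfg ∧ ∀ v (s : List (Finset V × ℝ)), ValidStrategy v s →
    utility a b c (Function.update cfg v s) v ≤ utility a b c cfg v

/-- A configuration supports the graph `G` when adjacency coincides with connection. -/
def Supports (cfg : Config V) (G : SimpleGraph V) : Prop :=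
  ∀ u v, G.Adj u v ↔ connected cfg u v

end Game

section Game

variable {V : Type*} [DecidableEq V]

/-- The rate at which the events of a single strategy `s` bring `u` and `v` together. -/
def stratRate (s : List (Finset V × ℝ)) (u v : V) : ℝ :=
  (s.map (fun e => if u ∈ e.1 ∧ v ∈ e.1 then e.2 else 0)).sum

lemma stratRate_nonneg {w : V} {s : List (Finset V × ℝ)} (hs : ValidStrategy w s) (u v : V) :
    0 ≤ stratRate s u v := by
  refine List.sum_nonneg fun x hx => ?_
  obtain ⟨e, he, rfl⟩ := List.mem_map.1 hx
  have := (hs e he).2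
  split_ifs <;> linarith

lemma stratRate_append (s t : List (Finset V × ℝ)) (u v : V) :
    stratRate (s ++ t) u v = stratRate s u v + stratRate t u v := by
  simp [stratRate]

lemma stratCost_append (b c : ℝ) (v : V) (s t : List (Finset V × ℝ)) :
    stratCost b c v (s ++ t) = stratCost b c v s + stratCost b c v t := by
  simp [stratCost]

lemma stratCost_nonneg {b c : ℝ} (hb : 0 ≤ b) (hc : 0 ≤ c) {v : V} {s : List (Finset V × ℝ)}
    (hs : ValidStrategy v s) : 0 ≤ stratCost b c v s := by
  refine List.sum_nonneg fun x hx => ?_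
  obtain ⟨e, he, rfl⟩ := List.mem_map.1 hx
  have := (hs e he).2
  positivity

/-- The cost of a strategy, bounded below by the meeting rates it provides to a set `K` of
other agents together with the meeting rate it provides to any single agent `x`. -/
lemma stratRate_le_stratCost {b c : ℝ} (hb : 0 ≤ b) (hc : 0 ≤ c) {v : V} {K : Finset V}
    (hK : v ∉ K) (x : V) {s : List (Finset V × ℝ)} (hs : ValidStrategy v s) :
    c * ∑ u ∈ K, stratRate s u v + b * stratRate s x v ≤ stratCost b c v s := by
  induction s with
  | nil => simp [stratRate, stratCost]
  | cons e s ih =>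
    have ih := ih fun e' he' => hs e' (List.mem_cons_of_mem _ he')
    obtain ⟨hv, hr⟩ := hs e List.mem_cons_self
    simp only [stratRate, stratCost, List.map_cons, List.sum_cons, sum_add_distrib] at ih ⊢
    have hsum : ∑ u ∈ K, (if u ∈ e.1 ∧ v ∈ e.1 then e.2 else 0)
        ≤ e.2 * ((e.1.erase v).card : ℝ) := by
      rw [← sum_filter, sum_const, nsmul_eq_mul, mul_comm]
      refine mul_le_mul_of_nonneg_left ?_ hr.le
      refine Nat.cast_le.2 (card_le_card fun u hu => ?_)
      obtain ⟨huK, hue, -⟩ := mem_filter.1 hu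
      exact mem_erase.2 ⟨ne_of_mem_of_not_mem huK hK, hue⟩
    have hx : (if x ∈ e.1 ∧ v ∈ e.1 then e.2 else 0) ≤ e.2 := by
      split_ifs <;> linarith
    have h1 := mul_le_mul_of_nonneg_left hsum hc
    have h2 := mul_le_mul_of_nonneg_left hx hb
    linarith

variable [Fintype V]

lemma meet_update (cfg : Config V) (w : V) (s : List (Finset V × ℝ)) (u v : V) :
    meet (Function.update cfg w s) u v
      = meet cfg u v - stratRate (cfg w) u v + stratRate s u v := by
  have h1 := add_sum_erase univ (fun w' => rateBy (Function.update cfg w s) w' u v) (mem_univ w)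
  have h2 := add_sum_erase univ (fun w' => rateBy cfg w' u v) (mem_univ w)
  have h3 : ∑ w' ∈ univ.erase w, rateBy (Function.update cfg w s) w' u v
      = ∑ w' ∈ univ.erase w, rateBy cfg w' u v :=
    sum_congr rfl fun w' hw' => by simp [rateBy, Function.update_of_ne (ne_of_mem_erase hw')]
  have h4 : rateBy (Function.update cfg w s) w u v = stratRate s u v := by
    simp [rateBy, stratRate]
  have h5 : rateBy cfg w u v = stratRate (cfg w) u v := rfl
  simp only [meet] at *
  linarith

lemma meet_nonneg {cfg : Config V} (hcfg : ConfigValid cfg) (u v : V) : 0 ≤ meet cfg u v :=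
  sum_nonneg fun w _ => stratRate_nonneg (hcfg w) u v

lemma mem_nbrs {cfg : Config V} {u v : V} : u ∈ nbrs cfg v ↔ connected cfg u v := by
  simp [nbrs]

lemma notMem_nbrs_self (cfg : Config V) (v : V) : v ∉ nbrs cfg v :=
  fun h => (mem_nbrs.1 h).1 rfl

lemma card_nbrs_le (cfg : Config V) (v : V) : (nbrs cfg v).card ≤ (univ.erase v).card :=
  card_le_card fun u hu => mem_erase.2 ⟨(mem_nbrs.1 hu).1, mem_univ u⟩

/-- An agent strictly gains by privately meeting, at rate `1`, an agent she is not connected to. -/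
lemma utility_lt_utility_update_pair {a b c : ℝ} (ha : 0 < a) (habc : b + c < a)
    {cfg : Config V} {u v : V} (huv : u ≠ v) (hcfg : ConfigValid cfg) (h : ¬ connected cfg u v) :
    utility a b c cfg v
      < utility a b c (Function.update cfg v (cfg v ++ [({v, u}, 1)])) v := by
  have hmeet (x : V) : meet (Function.update cfg v (cfg v ++ [({v, u}, 1)])) x v
      = meet cfg x v + stratRate [({v, u}, 1)] x v := by
    rw [meet_update, stratRate_append]; ring
  have hvalid : ValidStrategy v [(({v, u} : Finset V), (1 : ℝ))] := by
    simp [ValidStrategy]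
  have hsub : insert u (nbrs cfg v)
      ⊆ nbrs (Function.update cfg v (cfg v ++ [({v, u}, 1)])) v := by
    intro x hx
    rw [mem_nbrs, connected, hmeet]
    rcases mem_insert.1 hx with rfl | hx
    · have : stratRate [(({v, x} : Finset V), (1 : ℝ))] x v = 1 := by simp [stratRate]
      exact ⟨huv, by linarith [meet_nonneg hcfg x v]⟩
    · obtain ⟨hxv, hx⟩ := mem_nbrs.1 hx
      exact ⟨hxv, by linarith [stratRate_nonneg hvalid x v]⟩
  have hcard := card_le_card hsub
  rw [card_insert_of_notMem fun hu => h (mem_nbrs.1 hu)] at hcard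
  have hcard' : ((nbrs cfg v).card : ℝ) + 1
      ≤ ((nbrs (Function.update cfg v (cfg v ++ [({v, u}, 1)])) v).card : ℝ) := by
    exact_mod_cast hcard
  have hcost : stratCost b c v [(({v, u} : Finset V), (1 : ℝ))] = c + b := by
    have : ({v, u} : Finset V).erase v = {u} := erase_insert (by simpa using huv.symm)
    simp [stratCost, this]
  rw [utility, utility, Function.update_self, stratCost_append, hcost]
  nlinarith

/-- The configuration in which `w` holds the event of all agents at rate `1`. -/
def universalEvent (w : V) : Config V := Function.update (fun _ => []) w [(univ, 1)]

lemma meet_universalEvent (w u v : V) : meet (universalEvent w) u v = 1 := by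
  rw [universalEvent, meet_update]
  simp [meet, rateBy, stratRate]

lemma nbrs_universalEvent (w v : V) : nbrs (universalEvent w) v = univ.erase v := by
  ext u
  simp [mem_nbrs, connected, meet_universalEvent]

lemma stable_universalEvent [Nontrivial V] {a b c : ℝ} (ha : 0 < a) (hb : 0 < b) (hc : 0 < c)
    (habc : b + c < a) (w : V) : Stable a b c (universalEvent w) := by
  refine ⟨fun v => ?_, fun v s hs => ?_⟩
  · rcases eq_or_ne v w with rfl | hv
    · simp [ValidStrategy, universalEvent]
    · simp [ValidStrategy, universalEvent, Function.update_of_ne hv]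
  have hle : ((nbrs (Function.update (universalEvent w) v s) v).card : ℝ)
      ≤ ((univ.erase v).card : ℝ) := by
    exact_mod_cast card_nbrs_le _ v
  rw [utility, utility, nbrs_universalEvent, Function.update_self]
  rcases eq_or_ne v w with rfl | hv
  · have hcost : stratCost b c v (universalEvent v v) = c * ((univ.erase v).card : ℝ) + b := by
      simp [stratCost, universalEvent]
    rw [hcost]
    rcases (nbrs (Function.update (universalEvent v) v s) v).eq_empty_or_nonempty with h | ⟨x, hx⟩
    · obtain ⟨x, hx⟩ := exists_ne v
      have hone : (1 : ℝ) ≤ ((univ.erase v).card : ℝ) := by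
        exact_mod_cast card_pos.2 ⟨x, mem_erase.2 ⟨hx, mem_univ x⟩⟩
      rw [h, card_empty, Nat.cast_zero]
      nlinarith [stratCost_nonneg hb.le hc.le hs]
    · have hrate : ∀ u ∈ nbrs (Function.update (universalEvent v) v s) v,
          1 ≤ stratRate s u v := by
        intro u hu
        have := (mem_nbrs.1 hu).2
        rw [universalEvent, Function.update_idem, meet_update] at this
        simpa [meet, rateBy, stratRate] using this
      have hsum := card_nsmul_le_sum _ _ _ hrate
      rw [nsmul_eq_mul, mul_one] at hsum
      have hbound := stratRate_le_stratCost hb.le hc.le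
        (notMem_nbrs_self (Function.update (universalEvent v) v s) v) x hs
      have h1 := mul_le_mul_of_nonneg_left hsum hc.le
      have h2 := mul_le_mul_of_nonneg_left (hrate x hx) hb.le
      have h3 := mul_le_mul_of_nonneg_left hle (by linarith : 0 ≤ a - c)
      linarith
  · have hcost : stratCost b c v (universalEvent w v) = 0 := by
      simp [stratCost, universalEvent, Function.update_of_ne hv]
    rw [hcost]
    nlinarith [stratCost_nonneg hb.le hc.le hs]

lemma stable_nil_of_subsingleton [Subsingleton V] {a b c : ℝ} (hb : 0 ≤ b) (hc : 0 ≤ c) :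
    Stable a b c (fun _ : V => []) := by
  refine ⟨fun v => by simp [ValidStrategy], fun v s hs => ?_⟩
  have hnbrs (cfg : Config V) : nbrs cfg v = ∅ :=
    eq_empty_of_forall_notMem fun u hu => (mem_nbrs.1 hu).1 (Subsingleton.elim u v)
  rw [utility, utility, hnbrs, hnbrs, Function.update_self]
  have h0 : stratCost b c v [] = 0 := by simp [stratCost]
  linarith [stratCost_nonneg hb hc hs]

end Game

/-- For `γ = a/c > 1` and `b < c(γ - 1)`, the complete graph is the
unique supportable network: (i) some stable configuration connects every pair of agents
(e.g. a single agent holding the event `V` at rate 1), and (ii) every stable configuration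
connects every pair of agents. -/
theorem complete_graph_unique_supportable {V : Type*} [Fintype V] [DecidableEq V]
    [Nonempty V] (a b c : ℝ) (ha : 0 < a) (hb : 0 < b) (hc : 0 < c)
    (hγ : 1 < a / c) (hbc : b < c * (a / c - 1)) :
    (∃ cfg : Config V, Stable a b c cfg ∧ ∀ u v : V, u ≠ v → connected cfg u v) ∧
    (∀ cfg : Config V, Stable a b c cfg → ∀ u v : V, u ≠ v → connected cfg u v) := by
  have habc : b + c < a := by
    have : c * (a / c) = a := mul_div_cancel₀ a hc.ne'
    linarith
  refine ⟨?_, fun cfg hcfg u v huv => ?_⟩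
  · rcases subsingleton_or_nontrivial V with hV | hV
    · exact ⟨_, stable_nil_of_subsingleton hb.le hc.le,
        fun u v huv => (huv (Subsingleton.elim u v)).elim⟩
    · exact ⟨_, stable_universalEvent ha hb hc habc (Classical.arbitrary V),
        fun u v huv => ⟨huv, (meet_universalEvent _ u v).ge⟩⟩
  · by_contra h
    refine (utility_lt_utility_update_pair ha habc huv hcfg.1 h).not_ge (hcfg.2 v _ ?_)
    intro e he
    rcases List.mem_append.1 he with he | he
    · exact hcfg.1 v e he
    · simp [List.mem_singleton.1 he]
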